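/- Let G and f be probability densities on ℝ^d with I(G) := ∫|x|^{d+1} G(x) dx < ∞ and I(f) := ∫|x|^{d+1} f(x) dx < ∞. For ε > 0 define G_ε(x) = ε^{-d} G(x/ε). Then for every ε ≤ (1/I(G))^{1/(d+1)}, ∫_{ℝ^d} √((G_ε ∗ f)(x)) dx ≤ 2^{d/2} · A_d · (1 + I(f)), where A_d = ((2π)^{(d+1)/2}/Γ((d+1)/2))^{1/2} and ∗ denotes convolution. -/

import Mathlib

open MeasureTheory

lemma aux_gamma (s b : ℝ) (hs : 0 < s) (hb : 0 < b) :
    ∫⁻ t in Set.Ioi (0:ℝ), ENNReal.ofReal (t ^ (s - 1) * Real.exp (-(b * t)))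
      = ENNReal.ofReal ((1 / b) ^ s * Real.Gamma s) := by
  have key := Real.integral_rpow_mul_exp_neg_mul_Ioi hs hb
  have hG := Real.Gamma_pos_of_pos hs
  rw [← key, ofReal_integral_eq_lintegral_ofReal]
  · exact .of_integral_ne_zero (by rw [key]; positivity)
  · rw [Filter.EventuallyLE, ae_restrict_iff' measurableSet_Ioi]
    exact ae_of_all _ (fun x (hx : 0 < x) ↦ by simp only [Pi.zero_apply]; positivity)

lemma aux_gauss (d : ℕ) (t : ℝ) (ht : 0 < t) :
    ∫⁻ x : EuclideanSpace ℝ (Fin d), ENNReal.ofReal (Real.exp (-t * ‖x‖ ^ 2))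
      = ENNReal.ofReal ((Real.pi / t) ^ ((d:ℝ) / 2)) := by
  have key := GaussianFourier.integral_rexp_neg_mul_sq_norm (V := EuclideanSpace ℝ (Fin d)) ht
  have hp := Real.pi_pos
  rw [finrank_euclideanSpace_fin] at key
  rw [← key, ofReal_integral_eq_lintegral_ofReal]
  · exact .of_integral_ne_zero (by rw [key]; positivity)
  · exact ae_of_all _ fun x => by simp only [Pi.zero_apply]; positivity

lemma aux_weight (d : ℕ) :
    ∫⁻ x : EuclideanSpace ℝ (Fin d),
      ENNReal.ofReal ((1 / (1 + ‖x‖ ^ 2)) ^ (((d:ℝ) + 1) / 2))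
      = ENNReal.ofReal (Real.pi ^ (((d:ℝ) + 1) / 2) / Real.Gamma (((d:ℝ) + 1) / 2)) := by
  have hp := Real.pi_pos
  have hs : (0:ℝ) < ((d:ℝ) + 1) / 2 := by positivity
  set s : ℝ := ((d:ℝ) + 1) / 2 with hsdef
  have hG := Real.Gamma_pos_of_pos hs
  have h1 : (∫⁻ x : EuclideanSpace ℝ (Fin d),
      ENNReal.ofReal ((1 / (1 + ‖x‖ ^ 2)) ^ s)) * ENNReal.ofReal (Real.Gamma s)
      = ENNReal.ofReal (Real.pi ^ s) := by
    rw [← lintegral_mul_const _ (by fun_prop)]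
    have e1 : ∀ x : EuclideanSpace ℝ (Fin d),
        ENNReal.ofReal ((1 / (1 + ‖x‖ ^ 2)) ^ s) * ENNReal.ofReal (Real.Gamma s)
        = ∫⁻ t in Set.Ioi (0:ℝ),
          ENNReal.ofReal (t ^ (s - 1) * Real.exp (-((1 + ‖x‖ ^ 2) * t))) := by
      intro x
      rw [aux_gamma s _ hs (by positivity), ENNReal.ofReal_mul (by positivity)]
    simp_rw [e1]
    rw [lintegral_lintegral_swap (by fun_prop)]
    have e2 : ∀ t ∈ Set.Ioi (0:ℝ), (∫⁻ x : EuclideanSpace ℝ (Fin d),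
          ENNReal.ofReal (t ^ (s - 1) * Real.exp (-((1 + ‖x‖ ^ 2) * t))))
        = ENNReal.ofReal (Real.pi ^ ((d:ℝ)/2)) *
          ENNReal.ofReal (t ^ ((1/2:ℝ) - 1) * Real.exp (-(1 * t))) := by
      intro t ht
      have ht : 0 < t := ht
      have : ∀ x : EuclideanSpace ℝ (Fin d),
          ENNReal.ofReal (t ^ (s - 1) * Real.exp (-((1 + ‖x‖ ^ 2) * t)))
          = ENNReal.ofReal (t ^ (s - 1) * Real.exp (-t)) *
            ENNReal.ofReal (Real.exp (-t * ‖x‖ ^ 2)) := by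
        intro x
        rw [← ENNReal.ofReal_mul (by positivity), mul_assoc, ← Real.exp_add]
        congr 3
        ring
      simp_rw [this]
      rw [lintegral_const_mul _ (by fun_prop), aux_gauss d t ht,
        ← ENNReal.ofReal_mul (by positivity), ← ENNReal.ofReal_mul (by positivity)]
      congr 1
      rw [Real.div_rpow hp.le ht.le, one_mul,
        show s - 1 = ((1/2:ℝ) - 1) + (d:ℝ)/2 by rw [hsdef]; ring, Real.rpow_add ht]
      have : t ^ ((d:ℝ)/2) ≠ 0 := by positivity
      field_simp
    rw [setLIntegral_congr_fun measurableSet_Ioi e2, lintegral_const_mul _ (by fun_prop),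
      aux_gamma _ _ (by norm_num) (by norm_num), ← ENNReal.ofReal_mul (by positivity)]
    congr 1
    rw [Real.Gamma_one_half_eq, div_one, Real.one_rpow, one_mul, Real.sqrt_eq_rpow,
      ← Real.rpow_add hp]
    congr 1
    rw [hsdef]; ring
  rw [ENNReal.ofReal_div_of_pos hG, ENNReal.eq_div_iff (by simpa using hG) (by simp), mul_comm, h1]

lemma aux_pw (d : ℕ) (hd : 1 ≤ d) (r : ℝ) (hr : 0 ≤ r) :
    1 ≤ ((2:ℝ) ^ (((d:ℝ) - 1) / 2) * (1 + r ^ (d + 1))) *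
      (1 / (1 + r ^ 2)) ^ (((d:ℝ) + 1) / 2) := by
  have hd' : (1:ℝ) ≤ d := by exact_mod_cast hd
  have h := NNReal.rpow_add_le_mul_rpow_add_rpow 1 (⟨r, hr⟩ ^ 2)
    (p := ((d:ℝ) + 1) / 2) (by linarith)
  have h : (1 + r ^ 2) ^ (((d:ℝ) + 1) / 2) ≤
      (2:ℝ) ^ (((d:ℝ) + 1) / 2 - 1) * (1 ^ (((d:ℝ) + 1) / 2) + (r^2) ^ (((d:ℝ) + 1) / 2)) := by
    exact_mod_cast h
  have e : (r ^ 2) ^ (((d:ℝ) + 1) / 2) = r ^ (d + 1) := by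
    rw [← Real.rpow_natCast r 2, ← Real.rpow_mul hr, ← Real.rpow_natCast r (d+1)]
    congr 1; push_cast; ring
  rw [e, Real.one_rpow, show ((d:ℝ) + 1) / 2 - 1 = ((d:ℝ) - 1) / 2 by ring] at h
  rw [Real.div_rpow (by positivity) (by positivity), Real.one_rpow, mul_one_div,
    le_div_iff₀ (by positivity), one_mul]
  exact h

lemma aux_scale (d : ℕ) (ε : ℝ) (hε : 0 < ε) (F : EuclideanSpace ℝ (Fin d) → ENNReal)
    (hF : Measurable F) :
    ∫⁻ u, F (ε⁻¹ • u) = ENNReal.ofReal (ε ^ d) * ∫⁻ z, F z := by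
  have h := Measure.map_addHaar_smul (volume : Measure (EuclideanSpace ℝ (Fin d)))
    (r := ε⁻¹) (by positivity)
  rw [← lintegral_map (f := F) (g := fun u : EuclideanSpace ℝ (Fin d) => ε⁻¹ • u) hF (by fun_prop),
    h, lintegral_smul_measure, finrank_euclideanSpace_fin, smul_eq_mul]
  congr 2
  rw [inv_pow, inv_inv, abs_of_pos (by positivity)]

lemma aux_norm (d : ℕ) (ε : ℝ) (hε : 0 < ε) (z y : EuclideanSpace ℝ (Fin d)) :
    ‖ε • z + y‖ ^ (d + 1) ≤ 2 ^ d * (‖y‖ ^ (d + 1) + ε ^ (d + 1) * ‖z‖ ^ (d + 1)) := by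
  calc ‖ε • z + y‖ ^ (d + 1) ≤ (ε * ‖z‖ + ‖y‖) ^ (d + 1) := by
        gcongr
        refine (norm_add_le _ _).trans ?_
        rw [norm_smul, Real.norm_of_nonneg hε.le]
    _ ≤ 2 ^ (d + 1 - 1) * ((ε * ‖z‖) ^ (d + 1) + ‖y‖ ^ (d + 1)) :=
        add_pow_le (by positivity) (by positivity) _
    _ = _ := by rw [mul_pow]; simp only [Nat.add_sub_cancel]; ring

lemma aux_inner (d : ℕ)
    (G f : EuclideanSpace ℝ (Fin d) → ℝ)
    (hGmeas : Measurable G)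
    (hGnonneg : ∀ x, 0 ≤ G x) (hfnonneg : ∀ x, 0 ≤ f x)
    (hGint : Integrable G)
    (hGprob : ∫ x, G x = 1)
    (hGmom : Integrable (fun x => ‖x‖ ^ (d + 1) * G x))
    (ε : ℝ) (hε : 0 < ε) (C : ℝ) (hC : 0 ≤ C)
    (hεle : ε ^ (d + 1) * ∫ x, ‖x‖ ^ (d + 1) * G x ≤ 1)
    (y : EuclideanSpace ℝ (Fin d)) :
    ∫⁻ x, ENNReal.ofReal ((1 / ε ^ d) * G (ε⁻¹ • (x - y)) * f y) *
      ENNReal.ofReal (C * (1 + ‖x‖ ^ (d + 1))) ≤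
    ENNReal.ofReal (C * ((1 + 2 ^ d) * f y + 2 ^ d * (‖y‖ ^ (d + 1) * f y))) := by
  have hfy := hfnonneg y
  let F : EuclideanSpace ℝ (Fin d) → ENNReal := fun z =>
    ENNReal.ofReal ((1 / ε ^ d) * G z * f y) *
      ENNReal.ofReal (C * (1 + ‖ε • z + y‖ ^ (d + 1)))
  have hF : Measurable F := by fun_prop
  have e1 : ∫⁻ x, ENNReal.ofReal ((1 / ε ^ d) * G (ε⁻¹ • (x - y)) * f y) *
      ENNReal.ofReal (C * (1 + ‖x‖ ^ (d + 1))) = ∫⁻ x, F (ε⁻¹ • (x - y)) := by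
    congr 1; ext x
    simp only [F]
    rw [smul_inv_smul₀ hε.ne', sub_add_cancel]
  rw [e1, lintegral_sub_right_eq_self (fun u => F (ε⁻¹ • u)) y, aux_scale d ε hε F hF]
  have hi : Integrable (fun z => (1 / ε ^ d) * f y * C * ((1 + 2 ^ d * ‖y‖ ^ (d+1)) * G z +
      2 ^ d * ε ^ (d+1) * (‖z‖ ^ (d+1) * G z))) :=
    ((hGint.const_mul _).add (hGmom.const_mul _)).const_mul _
  have b1 : ∫⁻ z, F z ≤ ENNReal.ofReal (∫ z, (1 / ε ^ d) * f y * C *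
      ((1 + 2 ^ d * ‖y‖ ^ (d+1)) * G z + 2 ^ d * ε ^ (d+1) * (‖z‖ ^ (d+1) * G z))) := by
    rw [ofReal_integral_eq_lintegral_ofReal hi]
    · refine lintegral_mono fun z => ?_
      have hGz := hGnonneg z
      simp only [F]
      rw [← ENNReal.ofReal_mul (by positivity)]
      refine ENNReal.ofReal_le_ofReal ?_
      calc _ ≤ 1 / ε ^ d * G z * f y * (C * (1 + 2 ^ d * (‖y‖ ^ (d + 1) + ε ^ (d + 1) * ‖z‖ ^ (d + 1)))) := by
            gcongr; exact aux_norm d ε hε z y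
        _ = _ := by ring
    · refine ae_of_all _ fun z => ?_
      have hGz := hGnonneg z
      simp only [Pi.zero_apply]; positivity
  rw [integral_const_mul, integral_add (hGint.const_mul _) (hGmom.const_mul _),
    integral_const_mul, integral_const_mul, hGprob] at b1
  refine (mul_le_mul_right b1 _).trans ?_
  rw [← ENNReal.ofReal_mul (by positivity)]
  refine ENNReal.ofReal_le_ofReal ?_
  set I := ∫ x, ‖x‖ ^ (d + 1) * G x
  have hεd : ε ^ d ≠ 0 := by positivity
  calc _ = f y * C * ((1 + 2 ^ d * ‖y‖ ^ (d+1)) + 2 ^ d * (ε ^ (d+1) * I)) := by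
        field_simp
    _ ≤ f y * C * ((1 + 2 ^ d * ‖y‖ ^ (d+1)) + 2 ^ d * 1) := by gcongr
    _ = _ := by ring

/-- For probability densities `G, f` on `ℝ^d` with finite `(d+1)`-moments and
`G_ε(x) = ε^{-d} G(x/ε)`: if `0 < ε ≤ (1/I(G))^{1/(d+1)}` then
`∫ √(G_ε ∗ f) ≤ 2^{d/2} · A_d · (1 + I(f))`. -/
theorem sqrt_convolution_bound (d : ℕ) (hd : 1 ≤ d)
    (G f : EuclideanSpace ℝ (Fin d) → ℝ)
    (hGmeas : Measurable G) (hfmeas : Measurable f)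
    (hGnonneg : ∀ x, 0 ≤ G x) (hfnonneg : ∀ x, 0 ≤ f x)
    (hGint : Integrable G) (hfint : Integrable f)
    (hGprob : ∫ x, G x = 1) (hfprob : ∫ x, f x = 1)
    (hGmom : Integrable (fun x => ‖x‖ ^ (d + 1) * G x))
    (hfmom : Integrable (fun x => ‖x‖ ^ (d + 1) * f x))
    (ε : ℝ) (hε : 0 < ε)
    (hεle : ε ≤ (1 / ∫ x, ‖x‖ ^ (d + 1) * G x) ^ ((1:ℝ) / ((d:ℝ) + 1))) :
    (∫⁻ x, ENNReal.ofReal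
        (Real.sqrt (∫ y, (1 / ε ^ d) * G (ε⁻¹ • (x - y)) * f y))) ≤
      ENNReal.ofReal
        ((2:ℝ) ^ ((d:ℝ) / 2) *
          Real.sqrt ((2 * Real.pi) ^ (((d:ℝ) + 1) / 2) / Real.Gamma (((d:ℝ) + 1) / 2)) *
          (1 + ∫ x, ‖x‖ ^ (d + 1) * f x)) := by
  set I := ∫ x, ‖x‖ ^ (d + 1) * G x with hI
  set J := ∫ x, ‖x‖ ^ (d + 1) * f x with hJ
  have hJ0 : 0 ≤ J := integral_nonneg fun x => mul_nonneg (by positivity) (hfnonneg x)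
  have hI0 : 0 ≤ I := integral_nonneg fun x => mul_nonneg (by positivity) (hGnonneg x)
  have hεI : ε ^ (d + 1) * I ≤ 1 := by
    rcases hI0.eq_or_lt with h | h
    · rw [← h]; simp
    · have h2 : ε ^ (d + 1) ≤ ((1 / I) ^ ((1:ℝ) / ((d:ℝ) + 1))) ^ (d + 1) := by gcongr
      rw [← Real.rpow_natCast (_ ^ _) (d+1), ← Real.rpow_mul (by positivity)] at h2
      have : (1:ℝ) / ((d:ℝ) + 1) * ((d + 1 : ℕ) : ℝ) = 1 := by push_cast; field_simp
      rw [this, Real.rpow_one] at h2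
      rwa [le_div_iff₀ h] at h2
  let C : ℝ := (2:ℝ) ^ (((d:ℝ) - 1) / 2)
  have hC : 0 < C := by positivity
  let H : EuclideanSpace ℝ (Fin d) → ENNReal := fun x =>
    ∫⁻ y, ENNReal.ofReal ((1 / ε ^ d) * G (ε⁻¹ • (x - y)) * f y)
  let W : EuclideanSpace ℝ (Fin d) → ENNReal := fun x =>
    ENNReal.ofReal (C * (1 + ‖x‖ ^ (d + 1)))
  let V : EuclideanSpace ℝ (Fin d) → ENNReal := fun x =>
    ENNReal.ofReal ((1 / (1 + ‖x‖ ^ 2)) ^ (((d:ℝ) + 1) / 2))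
  have hk : Measurable (fun p : EuclideanSpace ℝ (Fin d) × EuclideanSpace ℝ (Fin d) =>
      ENNReal.ofReal ((1 / ε ^ d) * G (ε⁻¹ • (p.1 - p.2)) * f p.2)) := by fun_prop
  have hH : Measurable H := hk.lintegral_prod_right'
  have hW : Measurable W := by fun_prop
  have hV : Measurable V := by fun_prop
  have hVW : ∀ x, 1 ≤ W x * V x := by
    intro x
    simp only [W, V]
    rw [← ENNReal.ofReal_mul (by positivity), ENNReal.one_le_ofReal]
    exact aux_pw d hd _ (norm_nonneg x)
  -- the weighted integral of the convolution
  have hM : ∫⁻ x, H x * W x ≤ ENNReal.ofReal (C * ((1 + 2 ^ d) + 2 ^ d * J)) := by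
    have e1 : ∀ x, H x * W x = ∫⁻ y, ENNReal.ofReal ((1 / ε ^ d) * G (ε⁻¹ • (x - y)) * f y) * W x :=
      fun x => (lintegral_mul_const _ (by fun_prop)).symm
    simp_rw [e1]
    rw [lintegral_lintegral_swap (by
      exact (hk.mul (hW.comp measurable_fst)).aemeasurable)]
    refine (lintegral_mono fun y => aux_inner d G f hGmeas hGnonneg hfnonneg hGint hGprob hGmom
      ε hε C hC.le hεI y).trans ?_
    have hi : Integrable (fun y => C * ((1 + 2 ^ d) * f y + 2 ^ d * (‖y‖ ^ (d + 1) * f y))) :=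
      ((hfint.const_mul _).add (hfmom.const_mul _)).const_mul _
    rw [← ofReal_integral_eq_lintegral_ofReal hi, integral_const_mul,
      integral_add (hfint.const_mul _) (hfmom.const_mul _),
      integral_const_mul, integral_const_mul, hfprob, mul_one]
    refine ae_of_all _ fun y => ?_
    have := hfnonneg y
    simp only [Pi.zero_apply]; positivity
  -- pointwise bound
  have hpt : ∀ x, ENNReal.ofReal (Real.sqrt (∫ y, (1 / ε ^ d) * G (ε⁻¹ • (x - y)) * f y)) ≤
      ((fun x => (H x * W x) ^ (1/2:ℝ)) * (fun x => V x ^ (1/2:ℝ))) x := by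
    intro x
    have h0 : ∀ y, 0 ≤ (1 / ε ^ d) * G (ε⁻¹ • (x - y)) * f y := fun y =>
      mul_nonneg (mul_nonneg (by positivity) (hGnonneg _)) (hfnonneg y)
    have hh : ENNReal.ofReal (∫ y, (1 / ε ^ d) * G (ε⁻¹ • (x - y)) * f y) ≤ H x := by
      rw [integral_eq_lintegral_of_nonneg_ae (ae_of_all _ h0)
        (Measurable.aestronglyMeasurable (by fun_prop))]
      exact ENNReal.ofReal_toReal_le
    rw [Real.sqrt_eq_rpow, ← ENNReal.ofReal_rpow_of_nonneg (integral_nonneg h0) (by norm_num),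
      Pi.mul_apply, ← ENNReal.mul_rpow_of_nonneg _ _ (by norm_num)]
    refine ENNReal.rpow_le_rpow (hh.trans ?_) (by norm_num)
    rw [mul_assoc]
    exact le_mul_of_one_le_right' (hVW x)
  refine (lintegral_mono hpt).trans ?_
  refine (ENNReal.lintegral_mul_le_Lp_mul_Lq volume Real.HolderConjugate.two_two
    (by fun_prop) (by fun_prop)).trans ?_
  have hsq : ∀ a : ENNReal, (a ^ (1/2:ℝ)) ^ (2:ℝ) = a := fun a => by
    rw [← ENNReal.rpow_mul]; norm_num
  simp_rw [hsq]
  have hp := Real.pi_pos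
  have hs : (0:ℝ) < ((d:ℝ) + 1) / 2 := by positivity
  have hGam := Real.Gamma_pos_of_pos hs
  have hVint : ∫⁻ x, V x = _ := aux_weight d
  rw [hVint, ← ENNReal.mul_rpow_of_nonneg _ _ (by norm_num)]
  refine (ENNReal.rpow_le_rpow (mul_le_mul_left hM _) (by norm_num)).trans ?_
  rw [← ENNReal.ofReal_mul (by positivity), ENNReal.ofReal_rpow_of_nonneg (by positivity) (by norm_num)]
  refine ENNReal.ofReal_le_ofReal ?_
  rw [← Real.sqrt_eq_rpow]
  refine Real.sqrt_le_iff.2 ⟨by positivity, ?_⟩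
  have s1 : ((2:ℝ) ^ ((d:ℝ) / 2)) ^ 2 = 2 ^ d := by
    rw [← Real.rpow_natCast (_ ^ _) 2, ← Real.rpow_mul (by norm_num), ← Real.rpow_natCast 2 d]
    congr 1; push_cast; ring
  rw [mul_pow, mul_pow, s1, Real.sq_sqrt (by positivity), Real.mul_rpow (by norm_num) hp.le]
  have s2 : (2:ℝ) ^ (((d:ℝ) + 1) / 2) = C * 2 := by
    simp only [C]
    rw [← Real.rpow_add_one (by norm_num)]
    congr 1; ring
  rw [s2]
  set Q := Real.pi ^ (((d:ℝ) + 1) / 2)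
  set Γ := Real.Gamma (((d:ℝ) + 1) / 2)
  have hQ : 0 < Q := by positivity
  have h2d : (1:ℝ) ≤ 2 ^ d := one_le_pow₀ (by norm_num)
  have hfin : (1 + 2 ^ d) + 2 ^ d * J ≤ 2 * 2 ^ d * (1 + J) ^ 2 := by
    nlinarith [mul_nonneg hJ0 (by positivity : (0:ℝ) ≤ 2 ^ d), sq_nonneg J,
      mul_nonneg (sq_nonneg J) (by positivity : (0:ℝ) ≤ 2 ^ d)]
  calc C * ((1 + 2 ^ d) + 2 ^ d * J) * (Q / Γ)
      ≤ C * (2 * 2 ^ d * (1 + J) ^ 2) * (Q / Γ) := by gcongr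
    _ = _ := by ring
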